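/- Let μ > 0 and let y : [0,∞) → ℝ satisfy y(t) ≥ 0 for all t ≥ 0 and the integral inequality y(t) + μ ∫_s^t y(τ) dτ ≤ y(s) for all 0 ≤ s ≤ t. Then for every t ≥ 2/μ one has y(t) ≤ μ · e^{−μ t/2} · ∫_{t/2 − 1/μ}^{t/2} y(τ) dτ. -/

import Mathlib

open MeasureTheory Real

open Filter Topology

section IntegralDecay

variable {μ : ℝ} {y : ℝ → ℝ}

lemma antitoneOn_of_integral_ineq (hμ : 0 < μ) (hy_nonneg : ∀ t, 0 ≤ t → 0 ≤ y t)
    (hy : ∀ s t, 0 ≤ s → s ≤ t → y t + μ * ∫ τ in s..t, y τ ≤ y s) :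
    AntitoneOn y (Set.Ici 0) := by
  intro s hs t _ hst
  have hint : 0 ≤ ∫ τ in s..t, y τ :=
    intervalIntegral.integral_nonneg hst fun u hu => hy_nonneg u (le_trans hs hu.1)
  have := hy s t hs hst
  nlinarith [mul_nonneg hμ.le hint]

lemma AntitoneOn.sub_mul_le_integral (hanti : AntitoneOn y (Set.Ici 0)) {s t : ℝ}
    (hs : 0 ≤ s) (hst : s ≤ t) : (t - s) * y t ≤ ∫ τ in s..t, y τ := by
  have hint : IntervalIntegrable y volume s t := by
    refine AntitoneOn.intervalIntegrable (hanti.mono fun u hu => ?_)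
    rw [Set.uIcc_of_le hst] at hu
    exact le_trans hs hu.1
  have h := intervalIntegral.integral_mono_on hst
    (intervalIntegrable_const (c := y t)) hint
    fun u hu => hanti (le_trans hs hu.1) (le_trans hs hst) hu.2
  simpa using h

lemma one_add_pow_mul_le_of_integral_ineq (hμ : 0 < μ) (hy_nonneg : ∀ t, 0 ≤ t → 0 ≤ y t)
    (hy : ∀ s t, 0 ≤ s → s ≤ t → y t + μ * ∫ τ in s..t, y τ ≤ y s)
    {s d : ℝ} (hs : 0 ≤ s) (hd : 0 ≤ d) (n : ℕ) :
    (1 + μ * d) ^ n * y (s + n * d) ≤ y s := by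
  induction n with
  | zero => simp
  | succ n ih =>
    refine le_trans ?_ ih
    have h0 : 0 ≤ s + n * d := by positivity
    have hle : s + n * d ≤ s + (n + 1 : ℕ) * d := by push_cast; linarith
    have hI := (antitoneOn_of_integral_ineq hμ hy_nonneg hy).sub_mul_le_integral h0 hle
    have hstep := hy _ _ h0 hle
    have hsub : s + (n + 1 : ℕ) * d - (s + n * d) = d := by push_cast; ring
    rw [hsub] at hI
    rw [pow_succ, mul_assoc]
    refine mul_le_mul_of_nonneg_left ?_ (by positivity)
    linarith [mul_le_mul_of_nonneg_left hI hμ.le]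

lemma exp_mul_le_of_integral_ineq (hμ : 0 < μ) (hy_nonneg : ∀ t, 0 ≤ t → 0 ≤ y t)
    (hy : ∀ s t, 0 ≤ s → s ≤ t → y t + μ * ∫ τ in s..t, y τ ≤ y s)
    {s h : ℝ} (hs : 0 ≤ s) (hh : 0 ≤ h) :
    Real.exp (μ * h) * y (s + h) ≤ y s := by
  refine le_of_tendsto ((Real.tendsto_one_add_div_pow_exp (μ * h)).mul_const (y (s + h))) ?_
  filter_upwards [eventually_gt_atTop 0] with n hn
  have hn' : (n : ℝ) ≠ 0 := by positivity
  have := one_add_pow_mul_le_of_integral_ineq hμ hy_nonneg hy hs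
    (div_nonneg hh n.cast_nonneg) n
  rwa [mul_div_cancel₀ h hn', ← mul_div_assoc] at this

end IntegralDecay

/-- Corollary: if `y ≥ 0` on `[0,∞)` satisfies
`y t + μ ∫_s^t y ≤ y s` for all `0 ≤ s ≤ t`, then for `t ≥ 2/μ`,
`y t ≤ μ e^{-μ t/2} ∫_{t/2 - 1/μ}^{t/2} y`. -/
theorem stmt_1 (μ : ℝ) (hμ : 0 < μ) (y : ℝ → ℝ)
    (hy_nonneg : ∀ t, 0 ≤ t → 0 ≤ y t)
    (hy : ∀ s t, 0 ≤ s → s ≤ t → y t + μ * ∫ τ in s..t, y τ ≤ y s) :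
    ∀ t, 2 / μ ≤ t →
      y t ≤ μ * Real.exp (-(μ * t) / 2) * ∫ τ in (t / 2 - 1 / μ)..(t / 2), y τ := by
  intro t ht
  have hinv : 0 < 1 / μ := by positivity
  have hs : 0 ≤ t / 2 - 1 / μ := by
    have : 2 / μ = 2 * (1 / μ) := by ring
    linarith
  have hI := (antitoneOn_of_integral_ineq hμ hy_nonneg hy).sub_mul_le_integral hs
    (by linarith : t / 2 - 1 / μ ≤ t / 2)
  have hmean : y (t / 2) ≤ μ * ∫ τ in (t / 2 - 1 / μ)..(t / 2), y τ := by
    calc y (t / 2) = μ * ((t / 2 - (t / 2 - 1 / μ)) * y (t / 2)) := by field_simp; ring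
      _ ≤ _ := mul_le_mul_of_nonneg_left hI hμ.le
  have hdecay := exp_mul_le_of_integral_ineq hμ hy_nonneg hy
    (s := t / 2) (h := t / 2) (by linarith) (by linarith)
  rw [add_halves] at hdecay
  calc y t = Real.exp (-(μ * t) / 2) * (Real.exp (μ * (t / 2)) * y t) := by
        rw [← mul_assoc, ← Real.exp_add, show -(μ * t) / 2 + μ * (t / 2) = 0 by ring,
          Real.exp_zero, one_mul]
    _ ≤ Real.exp (-(μ * t) / 2) * (μ * ∫ τ in (t / 2 - 1 / μ)..(t / 2), y τ) :=
        mul_le_mul_of_nonneg_left (hdecay.trans hmean) (Real.exp_pos _).le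
    _ = _ := by ring
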